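/- Let n ≥ 2 be even and set α = n/2. Let r be the unique root in (0,1) of the polynomial 1 − 2x − x² + 2x^{α+1} − 2x^{α+2} + 2x^{2α+2}. Then the number of minimal strict shape 1 geodesics of length N satisfies lim_{N→∞} |O_n(N)|^{1/N} = 1/r. -/

import Mathlib

open Filter Topology

abbrev Letter : Type := Fin 2 × Bool

def sigmaD (n : ℕ) (x : ℕ →₀ ℤ) : ℤ := x.sum fun i c => c * (n : ℤ) ^ i

def l1D (x : ℕ →₀ ℤ) : ℕ := x.sum fun _ c => c.natAbs

def kIdx (x : ℕ →₀ ℤ) : ℕ := x.support.sup id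

noncomputable def wVec (n i : ℕ) : ℕ →₀ ℤ := Finsupp.single i (-(n : ℤ)) + Finsupp.single (i + 1) 1

def etaLen (u w : ℕ) (x : ℕ →₀ ℤ) : ℕ :=
  if kIdx x ≤ w ∨ u ≤ w then
    u + l1D x + kIdx x + ((w : ℤ) - kIdx x).natAbs
  else
    ((kIdx x : ℤ) - u).natAbs + l1D x + kIdx x + w

def BoxSet (n u w : ℕ) (v : ℤ) : Set (ℕ →₀ ℤ) :=
  {x | sigmaD n x = v ∧
    (∀ i < kIdx x, |x i| ≤ ((n / 2 : ℕ) : ℤ)) ∧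
    (kIdx x < max u w → |x (kIdx x)| ≤ ((n / 2 : ℕ) : ℤ)) ∧
    (max u w ≤ kIdx x → |x (kIdx x)| ≤ ((n / 2 : ℕ) : ℤ) + if n = 2 then 2 else 1)}

def absLexLE (x y : ℕ →₀ ℤ) : Prop :=
  (∀ i, |x i| = |y i|) ∨ ∃ i : ℕ, (∀ j < i, |x j| = |y j|) ∧ |x i| < |y i|

def IsMinimalVec (n u w : ℕ) (x : ℕ →₀ ℤ) : Prop :=
  (∀ y : ℕ →₀ ℤ, sigmaD n y = sigmaD n x → etaLen u w x ≤ etaLen u w y) ∧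
  (Even n → ∀ y : ℕ →₀ ℤ, sigmaD n y = sigmaD n x → etaLen u w y = etaLen u w x → absLexLE x y)

def tWord (m : ℤ) : List Letter := List.replicate m.natAbs (1, decide (0 < m))

def aWord (m : ℤ) : List Letter := List.replicate m.natAbs (0, decide (0 < m))

def eta1Word (u w : ℕ) (x : ℕ →₀ ℤ) : List Letter :=
  tWord (-(u : ℤ)) ++ aWord (x 0) ++
    (((List.range (kIdx x)).map fun j => tWord 1 ++ aWord (x (j + 1))).flatten) ++
    tWord ((w : ℤ) - kIdx x)

def OnLang (n : ℕ) : Set (List Letter) :=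
  {wd | ∃ (u w : ℕ) (x : ℕ →₀ ℤ), x ≠ 0 ∧
    x ∈ BoxSet n u w (sigmaD n x) ∧ IsMinimalVec n u w x ∧ kIdx x < w ∧
    wd = eta1Word u w x}

def okD (α : ℕ) (p d : ℤ) : Prop :=
  |d| ≤ α ∧ (p = α → 0 ≤ d ∧ d < α) ∧ (p = -α → -α < d ∧ d ≤ 0)

def lexK (K : ℕ) (x y : ℕ → ℤ) : Prop :=
  (∀ i < K, |x i| = |y i|) ∨ ∃ i < K, (∀ j < i, |x j| = |y j|) ∧ |x i| < |y i|

def sgK (n K : ℕ) (x : ℕ → ℤ) : ℤ := ∑ i ∈ Finset.range K, x i * (n : ℤ) ^ i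
def lK (K : ℕ) (x : ℕ → ℤ) : ℤ := ∑ i ∈ Finset.range K, |x i|

lemma sgK_succ (n K : ℕ) (x : ℕ → ℤ) :
    sgK n (K + 1) x = x 0 + n * sgK n K (fun i => x (i + 1)) := by
  unfold sgK
  rw [Finset.sum_range_succ', Finset.mul_sum, add_comm]
  congr 1
  · simp
  · apply Finset.sum_congr rfl; intros; ring

lemma lK_succ (K : ℕ) (x : ℕ → ℤ) :
    lK (K + 1) x = |x 0| + lK K (fun i => x (i + 1)) := by
  unfold lK
  rw [Finset.sum_range_succ', add_comm]

lemma lexK_lt {K : ℕ} {x y : ℕ → ℤ} (h : |x 0| < |y 0|) : lexK (K + 1) x y :=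
  Or.inr ⟨0, by omega, by intro j hj; omega, h⟩

lemma lexK_eq {K : ℕ} {x y : ℕ → ℤ} (h : |x 0| = |y 0|)
    (h' : lexK K (fun i => x (i + 1)) (fun i => y (i + 1))) : lexK (K + 1) x y := by
  rcases h' with h' | ⟨i, hi, h1, h2⟩
  · left
    rintro (_ | i) hi
    · exact h
    · exact h' i (by omega)
  · right
    refine ⟨i + 1, by omega, ?_, h2⟩
    rintro (_ | j) hj
    · exact h
    · exact h1 j (by omega)

def PP (n K : ℕ) (x : ℕ → ℤ) (c : ℤ) : Prop :=
  ∀ y, sgK n K y = sgK n K x + c → lK K x ≤ lK K y ∧ (lK K x = lK K y → lexK K x y)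

lemma PP_weak {n K : ℕ} {x : ℕ → ℤ} (h : PP n K x 0) (c : ℤ) (y : ℕ → ℤ)
    (hy : sgK n K y = sgK n K x + c) : lK K x ≤ lK K y + |c| := by
  rcases K with _ | K
  · simp [lK]
  · have := (h (fun i => if i = 0 then y 0 - c else y i) (by
      rw [sgK_succ] at hy ⊢
      simp
      linarith)).1
    rw [lK_succ K y]
    rw [lK_succ K (fun i => if i = 0 then y 0 - c else y i)] at this
    simp at this
    have := abs_sub (y 0) c
    linarith

lemma sgK_neg (n K : ℕ) (x : ℕ → ℤ) : sgK n K (fun i => - x i) = - sgK n K x := by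
  simp [sgK]

lemma lK_neg (K : ℕ) (x : ℕ → ℤ) : lK K (fun i => - x i) = lK K x := by
  simp [lK]

lemma PP_neg {n K : ℕ} {x : ℕ → ℤ} {c : ℤ} (h : PP n K (fun i => - x i) c) : PP n K x (-c) := by
  intro y hy
  have := h (fun i => - y i) (by rw [sgK_neg, sgK_neg, hy]; ring)
  rw [lK_neg, lK_neg] at this
  refine ⟨this.1, fun e => ?_⟩
  simpa [lexK] using this.2 e

lemma okD_neg {α : ℕ} {p d : ℤ} (h : okD α p d) : okD α (-p) (-d) := by
  obtain ⟨h1, h2, h3⟩ := h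
  refine ⟨by simpa using h1, fun e => ?_, fun e => ?_⟩
  · have := h3 (by omega); omega
  · have := h2 (by omega); omega

lemma PP_Q {α K : ℕ} (hα : 1 ≤ α) (x : ℕ → ℤ) (h0 : 0 ≤ x 0) (h1 : x 0 < α)
    (h : PP (2 * α) K (fun i => x (i + 1)) 0) : PP (2 * α) (K + 1) x 1 := by
  intro y hy
  rw [sgK_succ, sgK_succ] at hy
  set X := sgK (2 * α) K (fun i => x (i + 1))
  set Y := sgK (2 * α) K (fun i => y (i + 1)) with hY
  obtain ⟨c, hc⟩ : ∃ c, Y = X + c := ⟨Y - X, by ring⟩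
  have hw := PP_weak h c _ hc
  have e : y 0 = x 0 + 1 - 2 * α * c := by
    rw [hc] at hy; push_cast at hy; linarith
  rw [lK_succ, lK_succ]
  have key : |x 0| + |c| ≤ |y 0| ∧ |x 0| < |y 0| := by
    rw [abs_of_nonneg h0, e]
    rcases lt_trichotomy c 0 with hc | hc | hc
    · rw [abs_of_neg hc]
      have : (0:ℤ) ≤ (α - 1) * (-c) := by apply mul_nonneg <;> omega
      rw [abs_of_nonneg (by nlinarith)]
      constructor <;> nlinarith
    · subst hc; simp
      rw [abs_of_nonneg (by omega)]; omega
    · rw [abs_of_pos hc]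
      have : (0:ℤ) ≤ (2 * α - 1) * (c - 1) := by apply mul_nonneg <;> omega
      rw [abs_of_nonpos (by nlinarith)]
      constructor <;> nlinarith
  exact ⟨by linarith, fun _ => lexK_lt key.2⟩

lemma PP_all {α : ℕ} (hα : 1 ≤ α) (K : ℕ) : ∀ x : ℕ → ℤ, (∀ i, |x i| ≤ α) →
    (∀ i, okD α (x i) (x (i + 1))) → PP (2 * α) K x 0 ∧
      (0 ≤ x 0 → x 0 < α → PP (2 * α) K x 1) ∧ (-α < x 0 → x 0 ≤ 0 → PP (2 * α) K x (-1)) := by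
  induction K with
  | zero =>
    intro x _ _
    refine ⟨?_, ?_, ?_⟩
    · intro y _; simp [lK, lexK]
    · intro _ _ y hy; simp [sgK] at hy
    · intro _ _ y hy; simp [sgK] at hy
  | succ K ih =>
    intro x hb hv
    obtain ⟨i0, i1, i2⟩ := ih (fun i => x (i + 1)) (fun i => hb _) (fun i => hv _)
    refine ⟨?_, fun a b => PP_Q hα x a b i0, fun a b => ?_⟩
    · intro y hy
      rw [sgK_succ, sgK_succ] at hy
      set X := sgK (2 * α) K (fun i => x (i + 1)) with hX
      set Y := sgK (2 * α) K (fun i => y (i + 1)) with hY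
      obtain ⟨c, hc⟩ : ∃ c, Y = X + c := ⟨Y - X, by ring⟩
      have hw := PP_weak i0 c _ hc
      have e : y 0 = x 0 - 2 * α * c := by
        rw [hc] at hy; push_cast at hy; linarith
      rw [lK_succ, lK_succ]
      have hb0 := hb 0
      by_cases hc0 : c = 0
      · subst hc0
        have := i0 _ hc
        simp at e
        rw [e]
        exact ⟨by linarith, fun hh => lexK_eq (by rw [e]) (this.2 (by linarith))⟩
      by_cases hp : x 0 = α ∧ c = 1
      · obtain ⟨p1, rfl⟩ := hp
        have hq := (hv 0).2.1 p1
        have := i1 hq.1 hq.2 _ hc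
        have e2 : y 0 = - x 0 := by rw [e, p1]; ring
        rw [e2, abs_neg]
        exact ⟨by linarith, fun hh => lexK_eq (by rw [e2, abs_neg]) (this.2 (by linarith))⟩
      by_cases hm : x 0 = -α ∧ c = -1
      · obtain ⟨p1, rfl⟩ := hm
        have hq := (hv 0).2.2 p1
        have := i2 hq.1 hq.2 _ hc
        have e2 : y 0 = - x 0 := by rw [e, p1]; ring
        rw [e2, abs_neg]
        exact ⟨by linarith, fun hh => lexK_eq (by rw [e2, abs_neg]) (this.2 (by linarith))⟩
      have key : |x 0| + |c| ≤ |y 0| ∧ |x 0| < |y 0| := by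
        rw [abs_le] at hb0
        have h2 : 0 < |c| := by positivity
        suffices h : |x 0| + |c| ≤ |y 0| from ⟨h, by omega⟩
        rw [e]
        rcases lt_or_gt_of_ne hc0 with hc | hc
        · rw [abs_of_neg hc]
          rcases eq_or_lt_of_le (show c ≤ -1 by omega) with rfl | hc2
          · rw [abs_of_nonneg (show 0 ≤ x 0 - 2 * α * (-1) by omega)]
            rcases abs_cases (x 0) with ⟨h, _⟩ | ⟨h, _⟩ <;> rw [h] <;> omega
          · have : (0:ℤ) ≤ (α - 1) * (-c - 2) := by apply mul_nonneg <;> omega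
            rw [abs_of_nonneg (show 0 ≤ x 0 - 2 * α * c by nlinarith)]
            rcases abs_cases (x 0) with ⟨h, _⟩ | ⟨h, _⟩ <;> rw [h] <;> nlinarith
        · rw [abs_of_pos hc]
          rcases eq_or_lt_of_le (show 1 ≤ c by omega) with rfl | hc2
          · rw [abs_of_nonpos (show x 0 - 2 * α * 1 ≤ 0 by omega)]
            rcases abs_cases (x 0) with ⟨h, _⟩ | ⟨h, _⟩ <;> rw [h] <;> omega
          · have : (0:ℤ) ≤ (α - 1) * (c - 2) := by apply mul_nonneg <;> omega
            rw [abs_of_nonpos (show x 0 - 2 * α * c ≤ 0 by nlinarith)]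
            rcases abs_cases (x 0) with ⟨h, _⟩ | ⟨h, _⟩ <;> rw [h] <;> nlinarith
      exact ⟨by linarith, fun _ => lexK_lt key.2⟩
    · apply PP_neg
      apply PP_Q hα
      · simpa using b
      · omega
      · have := PP_neg (n := 2 * α) (K := K) (x := fun i => - x (i + 1)) (c := 0) (by simpa using i0)
        simpa using this

lemma kIdx_ge {x : ℕ →₀ ℤ} {i : ℕ} (h : x i ≠ 0) : i ≤ kIdx x :=
  Finset.le_sup (f := id) (by simpa using h)

lemma kIdx_le {x : ℕ →₀ ℤ} {w : ℕ} (h : ∀ i, w < i → x i = 0) : kIdx x ≤ w := by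
  apply Finset.sup_le
  intro i hi
  by_contra hc
  simp at hi hc
  exact hi (h i hc)

lemma supp_range {x : ℕ →₀ ℤ} {K : ℕ} (h : kIdx x < K) : x.support ⊆ Finset.range K := by
  intro i hi
  have := kIdx_ge (x := x) (i := i) (by simpa using hi)
  simp; omega

lemma sigmaD_eq (n : ℕ) {x : ℕ →₀ ℤ} {K : ℕ} (h : kIdx x < K) : sigmaD n x = sgK n K x :=
  Finsupp.sum_of_support_subset _ (supp_range h) _ (by simp)

lemma l1D_eq {x : ℕ →₀ ℤ} {K : ℕ} (h : kIdx x < K) : (l1D x : ℤ) = lK K x := by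
  unfold l1D
  rw [Finsupp.sum_of_support_subset _ (supp_range h) _ (by simp)]
  simp [lK]

lemma etaLen_of_le {u w : ℕ} {x : ℕ →₀ ℤ} (h : kIdx x ≤ w) : etaLen u w x = u + l1D x + w := by
  rw [etaLen, if_pos (Or.inl h)]; omega

lemma etaLen_ge (u w : ℕ) (x : ℕ →₀ ℤ) : u + l1D x + w ≤ etaLen u w x := by
  rw [etaLen]; split_ifs <;> omega

def Good (α : ℕ) (x : ℕ →₀ ℤ) : Prop :=
  (∀ i, |x i| ≤ α) ∧ ∀ i, okD α (x i) (x (i + 1))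

lemma good_min {α u w : ℕ} (hα : 1 ≤ α) {x : ℕ →₀ ℤ} (hg : Good α x) (hk : kIdx x < w) :
    IsMinimalVec (2 * α) u w x := by
  have key : ∀ y : ℕ →₀ ℤ, sigmaD (2 * α) y = sigmaD (2 * α) x →
      l1D x ≤ l1D y ∧ (l1D x = l1D y → absLexLE x y) := by
    intro y hy
    set K := max (kIdx x) (kIdx y) + 1 with hK
    have k1 : kIdx x < K := by omega
    have k2 : kIdx y < K := by omega
    have := ((PP_all hα K x hg.1 hg.2).1 y (by rw [← sigmaD_eq _ k1, ← sigmaD_eq _ k2, hy]; simp))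
    rw [← l1D_eq k1, ← l1D_eq k2] at this
    refine ⟨by exact_mod_cast this.1, fun e => ?_⟩
    rcases this.2 (by exact_mod_cast e) with h | ⟨i, _, h⟩
    · left
      intro i
      by_cases hi : i < K
      · exact h i hi
      · have h1 : x i = 0 := by
          by_contra hc; have := kIdx_ge hc; omega
        have h2 : y i = 0 := by
          by_contra hc; have := kIdx_ge hc; omega
        rw [h1, h2]
    · exact Or.inr ⟨i, h⟩
  have ex := etaLen_of_le (u := u) hk.le
  constructor
  · intro y hy
    have := (key y hy).1
    have := etaLen_ge u w y
    omega
  · intro _ y hy he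
    obtain ⟨h1, h2⟩ := key y hy
    have := etaLen_ge u w y
    exact h2 (by omega)

lemma sigmaD_add (n : ℕ) (x y : ℕ →₀ ℤ) : sigmaD n (x + y) = sigmaD n x + sigmaD n y :=
  Finsupp.sum_add_index' (by simp) (by intros; ring)

lemma sigmaD_wVec (n i : ℕ) : sigmaD n (wVec n i) = 0 := by
  rw [wVec, sigmaD_add]
  unfold sigmaD
  rw [Finsupp.sum_single_index (by simp), Finsupp.sum_single_index (by simp)]
  ring

lemma wVec_apply (n i j : ℕ) : wVec n i j = if j = i then -(n : ℤ) else if j = i + 1 then 1 else 0 := by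
  simp only [wVec, Finsupp.add_apply, Finsupp.single_apply]
  split_ifs <;> omega

lemma kIdx_neg (x : ℕ →₀ ℤ) : kIdx (-x) = kIdx x := by
  simp [kIdx]

lemma sigmaD_neg (n : ℕ) (x : ℕ →₀ ℤ) : sigmaD n (-x) = - sigmaD n x := by
  have := sigmaD_add n x (-x)
  simp at this
  have h0 : sigmaD n 0 = 0 := by simp [sigmaD]
  linarith

lemma l1D_neg (x : ℕ →₀ ℤ) : l1D (-x) = l1D x := by
  have h1 := l1D_eq (x := -x) (K := kIdx x + 1) (by rw [kIdx_neg]; omega)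
  have h2 := l1D_eq (x := x) (K := kIdx x + 1) (by omega)
  have : lK (kIdx x + 1) (-x : ℕ →₀ ℤ) = lK (kIdx x + 1) x := by simp [lK]
  omega

lemma etaLen_neg (u w : ℕ) (x : ℕ →₀ ℤ) : etaLen u w (-x) = etaLen u w x := by
  simp only [etaLen, kIdx_neg, l1D_neg]

lemma min_neg {n u w : ℕ} {x : ℕ →₀ ℤ} (h : IsMinimalVec n u w x) : IsMinimalVec n u w (-x) := by
  constructor
  · intro y hy
    have := h.1 (-y) (by rw [sigmaD_neg, hy, sigmaD_neg]; ring)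
    simpa only [etaLen_neg] using this
  · intro he y hy hl
    have := h.2 he (-y) (by rw [sigmaD_neg, hy, sigmaD_neg]; ring) (by simpa only [etaLen_neg] using hl)
    simpa [absLexLE] using this

lemma min_ok {α u w : ℕ} (hα : 1 ≤ α) {x : ℕ →₀ ℤ} (hb : ∀ i, |x i| ≤ α) (hk : kIdx x < w)
    (hm : IsMinimalVec (2 * α) u w x) (i : ℕ) (hi : x i = α) : 0 ≤ x (i + 1) ∧ x (i + 1) < α := by
  have ex := etaLen_of_le (u := u) hk.le
  constructor
  · by_contra hc
    push Not at hc
    have hik := kIdx_ge (x := x) (i := i + 1) (by omega)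
    set y := x + wVec (2 * α) i with hy
    have ya : ∀ j, y j = x j + wVec (2 * α) i j := fun j => by rw [hy]; rfl
    have ky : kIdx y ≤ w := by
      apply kIdx_le
      intro j hj
      rw [ya, wVec_apply, if_neg (by omega), if_neg (by omega)]
      by_contra hc; have := kIdx_ge (x := x) (i := j) (by simpa using hc); omega
    have h1 := hm.1 y (by rw [hy, sigmaD_add, sigmaD_wVec, add_zero])
    rw [ex, etaLen_of_le ky] at h1
    have e1 := l1D_eq (x := x) (K := w + 1) (by omega)
    have e2 := l1D_eq (x := y) (K := w + 1) (by omega)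
    have : lK (w + 1) y - lK (w + 1) x = ∑ j ∈ {i, i + 1}, (|y j| - |x j|) := by
      rw [lK, lK, ← Finset.sum_sub_distrib]
      symm
      apply Finset.sum_subset
      · intro j; simp; omega
      · intro j _ hj
        simp at hj
        rw [ya, wVec_apply, if_neg (by omega), if_neg (by omega)]; simp
    rw [Finset.sum_pair (by omega), ya, ya, wVec_apply, wVec_apply, if_pos rfl, if_neg (by omega),
      if_pos rfl, hi, abs_of_neg hc, abs_of_nonpos (show x (i + 1) + 1 ≤ 0 by omega),
      abs_of_nonpos (a := (α : ℤ) + -_) (by push_cast; omega), abs_of_nonneg (by omega)] at this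
    push_cast at this
    omega
  · by_contra hc
    have hc : x (i + 1) = α := by have := abs_le.1 (hb (i + 1)); omega
    have hik := kIdx_ge (x := x) (i := i + 1) (by omega)
    set y := x + (wVec (2 * α) i + wVec (2 * α) (i + 1)) with hy
    have ya : ∀ j, y j = x j + (wVec (2 * α) i j + wVec (2 * α) (i + 1) j) := fun j => by rw [hy]; rfl
    have y0 : ∀ j, j ≠ i → j ≠ i + 1 → j ≠ i + 2 → y j = x j := by
      intro j h1 h2 h3
      rw [ya, wVec_apply, wVec_apply, if_neg h1, if_neg h2, if_neg h2, if_neg (by omega)]; simp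
    have y1 : y i = - α := by
      rw [ya, wVec_apply, wVec_apply, if_pos rfl, if_neg (by omega), if_neg (by omega), hi]
      push_cast; ring
    have y2 : y (i + 1) = 1 - α := by
      rw [ya, wVec_apply, wVec_apply, if_neg (by omega), if_pos rfl, if_pos rfl, hc]
      push_cast; ring
    have y3 : y (i + 2) = x (i + 2) + 1 := by
      rw [ya, wVec_apply, wVec_apply, if_neg (by omega), if_neg (by omega), if_neg (by omega), if_pos (by omega)]
      ring
    have ky : kIdx y ≤ w := by
      apply kIdx_le
      intro j hj
      rw [y0 j (by omega) (by omega) (by omega)]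
      by_contra hc; have := kIdx_ge hc; omega
    have hs : sigmaD (2 * α) y = sigmaD (2 * α) x := by
      rw [hy, sigmaD_add, sigmaD_add, sigmaD_wVec, sigmaD_wVec]; simp
    have h1 := hm.1 y hs
    have e1 := l1D_eq (x := x) (K := w + 2) (by omega)
    have e2 := l1D_eq (x := y) (K := w + 2) (by omega)
    have : lK (w + 2) y - lK (w + 2) x = ∑ j ∈ {i, i + 1, i + 2}, (|y j| - |x j|) := by
      rw [lK, lK, ← Finset.sum_sub_distrib]
      symm
      apply Finset.sum_subset
      · intro j; simp; omega
      · intro j _ hj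
        simp at hj
        rw [y0 j (by omega) (by omega) (by omega)]; simp
    rw [Finset.sum_insert (by simp), Finset.sum_pair (by omega), y1, y2, y3, hi, hc, abs_neg,
      abs_of_nonneg (a := (α : ℤ)) (by omega), abs_of_nonpos (a := 1 - (α : ℤ)) (by omega)] at this
    have tri := abs_add_le (x (i + 2)) 1
    rw [abs_one] at tri
    have h2 := hm.2 (by simp) y hs (by rw [ex, etaLen_of_le ky] at *; omega)
    have a1 : |x (i + 1)| = α := by rw [hc]; simp
    have a2 : |y (i + 1)| = α - 1 := by rw [y2, abs_of_nonpos (by omega)]; ring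
    rcases h2 with h2 | ⟨j, h2, h3⟩
    · have := h2 (i + 1); omega
    · rcases lt_trichotomy j (i + 1) with h | rfl | h
      · rcases eq_or_ne j i with rfl | h'
        · rw [hi, y1] at h3; simp at h3
        · rw [y0 j h' (by omega) (by omega)] at h3; omega
      · omega
      · have := h2 _ h; omega

lemma good_iff {α u w : ℕ} (hα : 1 ≤ α) {x : ℕ →₀ ℤ} (hk : kIdx x < w) :
    (x ∈ BoxSet (2 * α) u w (sigmaD (2 * α) x) ∧ IsMinimalVec (2 * α) u w x) ↔ Good α x := by
  have hd : 2 * α / 2 = α := by omega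
  constructor
  · rintro ⟨⟨_, h1, h2, _⟩, hm⟩
    rw [hd] at h1 h2
    have hb : ∀ i, |x i| ≤ α := by
      intro i
      rcases lt_trichotomy i (kIdx x) with h | h | h
      · exact h1 i h
      · rw [h]; exact h2 (by omega)
      · have : x i = 0 := by
          by_contra hc; have := kIdx_ge hc; omega
        rw [this]; simp
    refine ⟨hb, fun i => ⟨hb _, min_ok hα hb hk hm i, fun e => ?_⟩⟩
    have := min_ok hα (x := -x) (u := u) (w := w) (by simpa using hb) (by rwa [kIdx_neg]) (min_neg hm) i
      (by simp [e])
    simp at this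
    omega
  · intro hg
    refine ⟨⟨rfl, ?_, ?_, ?_⟩, good_min hα hg hk⟩
    · intro i _; rw [hd]; exact hg.1 i
    · intro _; rw [hd]; exact hg.1 _
    · intro h; omega

def wordL : List ℤ → List Letter
  | [] => []
  | d :: l => aWord d ++ (1, true) :: wordL l

def wt : List ℤ → ℕ
  | [] => 0
  | d :: l => d.natAbs + 1 + wt l

def Val (α : ℕ) : ℤ → List ℤ → Prop
  | _, [] => True
  | p, d :: l => okD α p d ∧ Val α d l

lemma length_wordL (l : List ℤ) : (wordL l).length = wt l := by
  induction l with
  | nil => rfl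
  | cons d l ih => simp [wordL, wt, aWord, ih]; omega

lemma rep_inj (b b' : Bool) (s s' : List Letter) (m : ℕ) : ∀ m' : ℕ,
    List.replicate m ((0, b) : Letter) ++ (1, true) :: s =
      List.replicate m' ((0, b') : Letter) ++ (1, true) :: s' →
    m = m' ∧ (m ≠ 0 → b = b') ∧ s = s' := by
  induction m with
  | zero =>
    rintro (_ | m') h
    · simpa using h
    · simp [List.replicate_succ] at h
  | succ m ih =>
    rintro (_ | m') h
    · simp [List.replicate_succ] at h
    · simp [List.replicate_succ] at h
      have := ih m' h.2
      simp [this, h.1]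

lemma wordL_inj : Function.Injective wordL := by
  intro l
  induction l with
  | nil =>
    rintro (_ | ⟨d, l'⟩) h
    · rfl
    · simp [wordL] at h
  | cons d l ih =>
    rintro (_ | ⟨d', l'⟩) h
    · simp [wordL] at h
    · simp only [wordL, aWord] at h
      obtain ⟨h1, h2, h3⟩ := rep_inj _ _ _ _ _ _ h
      rw [ih h3]
      congr 1
      by_cases h0 : d = 0
      · subst h0; simp at h1; omega
      · have := h2 (by omega)
        simp at this
        omega

lemma wordL_append (l l' : List ℤ) : wordL (l ++ l') = wordL l ++ wordL l' := by
  induction l with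
  | nil => rfl
  | cons d l ih => simp [wordL, ih]

lemma wordL_zero (m : ℕ) : wordL (List.replicate m 0) = List.replicate m (1, true) := by
  induction m with
  | zero => rfl
  | succ m ih => simp [List.replicate_succ, wordL, aWord, ih]

lemma word_aux (x : ℕ → ℤ) (k : ℕ) :
    aWord (x 0) ++ (((List.range k).map fun j => tWord 1 ++ aWord (x (j + 1))).flatten) ++ [(1, true)]
      = wordL ((List.range (k + 1)).map x) := by
  induction k with
  | zero => simp [wordL]
  | succ k ih =>
    rw [List.range_succ (n := k + 1), List.map_append, wordL_append, ← ih, List.range_succ,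
      List.map_append, List.flatten_append]
    simp [wordL, tWord]

lemma eta_eq (u w : ℕ) (x : ℕ →₀ ℤ) (hk : kIdx x < w) :
    eta1Word u w x = List.replicate u (1, false) ++ wordL ((List.range w).map x) := by
  obtain ⟨m, rfl⟩ : ∃ m, w = kIdx x + 1 + m := ⟨w - (kIdx x + 1), by omega⟩
  have h1 : (List.range (kIdx x + 1 + m)).map x =
      (List.range (kIdx x + 1)).map x ++ List.replicate m 0 := by
    rw [List.range_add, List.map_append]
    congr 1
    rw [List.map_map]
    apply List.eq_replicate_iff.2
    simp
    intro a _
    by_contra hc; have := kIdx_ge hc; omega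
  rw [h1, wordL_append, ← word_aux, wordL_zero, eta1Word]
  have h2 : tWord (-(u : ℤ)) = List.replicate u (1, false) := by
    simp [tWord]
  have h3 : tWord (((kIdx x + 1 + m : ℕ) : ℤ) - kIdx x) = (1, true) :: List.replicate m (1, true) := by
    have : (((kIdx x + 1 + m : ℕ) : ℤ) - kIdx x) = (m + 1 : ℕ) := by push_cast; ring
    rw [this, tWord, ← List.replicate_succ]
    simp
    omega
  rw [h2, h3]
  simp

lemma Val_map (α : ℕ) (w : ℕ) : ∀ (p : ℤ) (x : ℕ → ℤ), okD α p (x 0) →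
    (∀ i, okD α (x i) (x (i + 1))) → Val α p ((List.range w).map x) := by
  induction w with
  | zero => intros; trivial
  | succ w ih =>
    intro p x hp h
    rw [List.range_succ_eq_map]
    simp only [List.map_cons, List.map_map]
    exact ⟨hp, ih (x 0) (x ∘ Nat.succ) (h 0) (fun i => h (i + 1))⟩

lemma okD_zero {α : ℕ} (hα : 1 ≤ α) (p : ℤ) : okD α p 0 := by
  refine ⟨by simp, fun _ => ⟨le_rfl, by omega⟩, fun _ => ⟨by omega, le_rfl⟩⟩

lemma Val_getD {α : ℕ} (hα : 1 ≤ α) (l : List ℤ) : ∀ (p : ℤ), Val α p l → okD α p (l.getD 0 0) ∧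
    ∀ i, okD α (l.getD i 0) (l.getD (i + 1) 0) := by
  induction l with
  | nil => intro p _; simp [okD_zero hα]
  | cons d l ih =>
    intro p h
    obtain ⟨h1, h2⟩ := ih d h.2
    refine ⟨by simpa using h.1, ?_⟩
    rintro (_ | i)
    · simpa using h1
    · simpa using h2 i

noncomputable def LS (α : ℕ) : ℕ → ℤ → ℕ → Finset (List ℤ)
  | _, _, 0 => {[]}
  | 0, _, _ + 1 => ∅
  | f + 1, p, m + 1 => by
      classical
      exact ((Finset.Icc (-(α : ℤ)) α).filter (fun d => okD α p d ∧ d.natAbs ≤ m)).biUnion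
        fun d => (LS α f d (m - d.natAbs)).image (List.cons d)

lemma mem_LS (α f : ℕ) : ∀ (p : ℤ) (m : ℕ), m ≤ f → ∀ l, l ∈ LS α f p m ↔ Val α p l ∧ wt l = m := by
  induction f with
  | zero =>
    intro p m hm l
    obtain rfl : m = 0 := by omega
    rcases l with _ | ⟨d, l⟩ <;> simp [LS, Val, wt]
  | succ f ih =>
    rintro p (_ | m) hm l
    · rcases l with _ | ⟨d, l⟩ <;> simp [LS, Val, wt]
    · simp only [LS, Finset.mem_biUnion, Finset.mem_filter, Finset.mem_image, Finset.mem_Icc]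
      constructor
      · rintro ⟨d, ⟨_, h1, h2⟩, l', h3, rfl⟩
        rw [ih _ _ (by omega)] at h3
        exact ⟨⟨h1, h3.1⟩, by simp only [wt]; omega⟩
      · rcases l with _ | ⟨d, l⟩
        · simp [wt]
        · rintro ⟨⟨h1, h2⟩, h3⟩
          simp only [wt] at h3
          refine ⟨d, ⟨abs_le.1 h1.1, h1, by omega⟩, l, ?_, rfl⟩
          rw [ih _ _ (by omega)]
          exact ⟨h2, by omega⟩

lemma card_LS (α f : ℕ) (p : ℤ) (m : ℕ) [DecidablePred (fun d => okD α p d ∧ d.natAbs ≤ m)] :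
    (LS α (f + 1) p (m + 1)).card =
    ∑ d ∈ (Finset.Icc (-(α : ℤ)) α).filter (fun d => okD α p d ∧ d.natAbs ≤ m),
      (LS α f d (m - d.natAbs)).card := by
  simp only [LS]
  rw [Finset.card_biUnion]
  · apply Finset.sum_congr
    · congr
    · intro d _
      rw [Finset.card_image_of_injective]
      intro a b h
      simpa using h
  · intro d _ d' _ hne
    rw [Function.onFun, Finset.disjoint_left]
    intro l h1 h2
    simp at h1 h2
    obtain ⟨a, _, rfl⟩ := h1
    obtain ⟨b, _, h⟩ := h2
    simp at h
    exact hne h.1.symm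

lemma upper_set {α : ℕ} (hα : 1 ≤ α) (N : ℕ) :
    (OnLang (2 * α) ∩ {wd : List Letter | wd.length = N}).Finite ∧
    (OnLang (2 * α) ∩ {wd : List Letter | wd.length = N}).ncard ≤
      ∑ u ∈ Finset.range (N + 1), (LS α N 0 (N - u)).card := by
  classical
  set T : Finset (List Letter) := (Finset.range (N + 1)).biUnion fun u =>
    (LS α N 0 (N - u)).image fun l => List.replicate u (1, false) ++ wordL l with hT
  have hsub : (OnLang (2 * α) ∩ {wd : List Letter | wd.length = N}) ⊆ T := by
    rintro wd ⟨⟨u, w, x, hx, hb, hm, hk, rfl⟩, hN⟩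
    have hg := (good_iff hα hk).1 ⟨hb, hm⟩
    simp only [Set.mem_ofPred_eq] at hN
    rw [eta_eq _ _ _ hk] at hN ⊢
    simp [length_wordL] at hN
    simp only [hT, Finset.coe_biUnion, Set.mem_iUnion, Finset.mem_coe, Finset.mem_image]
    refine ⟨u, by simp; omega, _, ?_, rfl⟩
    rw [mem_LS _ _ _ _ (by omega)]
    refine ⟨Val_map α w 0 x ⟨hg.1 0, fun h => by omega, fun h => by omega⟩ hg.2, by omega⟩
  refine ⟨T.finite_toSet.subset hsub, ?_⟩
  calc _ ≤ (T : Set (List Letter)).ncard := Set.ncard_le_ncard hsub T.finite_toSet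
    _ = T.card := Set.ncard_coe_finset T
    _ ≤ _ := Finset.card_biUnion_le
    _ ≤ _ := Finset.sum_le_sum fun u _ => Finset.card_image_le

lemma wt_zero (w : ℕ) : wt (List.replicate w 0) = w := by
  induction w with
  | zero => rfl
  | succ w ih => simp [List.replicate_succ, wt, ih]; omega

lemma lower_set {α : ℕ} (hα : 1 ≤ α) (N : ℕ) :
    (LS α N 0 N).card ≤ (OnLang (2 * α) ∩ {wd : List Letter | wd.length = N}).ncard + 1 := by
  classical
  have hsub : (((LS α N 0 N).erase (List.replicate N 0)).image wordL : Set (List Letter)) ⊆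
      OnLang (2 * α) ∩ {wd : List Letter | wd.length = N} := by
    intro wd h
    simp only [Finset.coe_image, Set.mem_image, Finset.mem_coe, Finset.mem_erase] at h
    obtain ⟨l, ⟨hl0, hl⟩, rfl⟩ := h
    rw [mem_LS _ _ _ _ le_rfl] at hl
    obtain ⟨hv, hw⟩ := hl
    refine ⟨?_, by simp [length_wordL, hw]⟩
    obtain ⟨g0, g1⟩ := Val_getD hα l 0 hv
    set x : ℕ →₀ ℤ := l.toFinsupp with hx
    have xa : ∀ i, x i = l.getD i 0 := fun i => by rw [hx]; exact List.toFinsupp_apply l i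
    have hmap : (List.range l.length).map x = l := by
      apply List.ext_getElem (by simp)
      intro i h1 h2
      simp only [List.getElem_map, List.getElem_range, xa]
      exact List.getD_eq_getElem _ _ h2
    have hg : Good α x := by
      refine ⟨?_, fun i => by rw [xa, xa]; exact g1 i⟩
      rintro (_ | i)
      · rw [xa]; exact g0.1
      · rw [xa]; exact (g1 i).1
    have hne : x ≠ 0 := by
      intro h0
      have : l = List.replicate l.length 0 := by
        conv_lhs => rw [← hmap, h0]
        apply List.eq_replicate_iff.2
        simp
      rw [this, wt_zero] at hw
      exact hl0 (by rw [this, hw])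
    have hlen : 0 < l.length := by
      rcases l with _ | ⟨d, l⟩
      · exfalso; apply hne; ext i; rw [xa]; simp
      · simp
    have hk : kIdx x < l.length := by
      have : kIdx x ≤ l.length - 1 := by
        apply kIdx_le
        intro i hi
        rw [xa]
        exact List.getD_eq_default _ _ (by omega)
      omega
    obtain ⟨hb, hm⟩ := (good_iff (u := 0) hα hk).2 hg
    refine ⟨0, l.length, x, hne, hb, hm, hk, ?_⟩
    rw [eta_eq _ _ _ hk, hmap]
    simp
  have h1 := Set.ncard_le_ncard hsub (upper_set hα N).1
  have h2 : (((LS α N 0 N).erase (List.replicate N 0)).image wordL : Set (List Letter)).ncard =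
      ((LS α N 0 N).erase (List.replicate N 0)).card := by
    rw [Set.ncard_coe_finset, Finset.card_image_of_injective _ wordL_inj]
  have := Finset.pred_card_le_card_erase (s := LS α N 0 N) (a := List.replicate N 0)
  omega

noncomputable def qq (α : ℕ) (r : ℝ) : ℝ := ∑ j ∈ Finset.range α, r ^ (j + 1)

noncomputable def phi (α : ℕ) (r : ℝ) (p : ℤ) : ℝ := if p.natAbs = α then qq α r else 1

lemma sum_sym (g : ℕ → ℝ) (a : ℕ) : ∑ d ∈ Finset.Icc (-(a : ℤ)) a, g d.natAbs =
    g 0 + 2 * ∑ j ∈ Finset.range a, g (j + 1) := by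
  induction a with
  | zero => simp
  | succ a ih =>
    have : Finset.Icc (-((a + 1 : ℕ) : ℤ)) ((a + 1 : ℕ) : ℤ) =
        insert (-((a + 1 : ℕ) : ℤ)) (insert ((a + 1 : ℕ) : ℤ) (Finset.Icc (-(a : ℤ)) a)) := by
      ext d; simp only [Finset.mem_insert, Finset.mem_Icc]; omega
    rw [this, Finset.sum_insert (by simp; omega), Finset.sum_insert (by simp), ih,
      Finset.sum_range_succ]
    have h1 : (-((a + 1 : ℕ) : ℤ)).natAbs = a + 1 := by omega
    have h2 : (((a + 1 : ℕ) : ℤ)).natAbs = a + 1 := by omega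
    rw [h1, h2]; ring

lemma qq_geom (a : ℕ) (r : ℝ) : (1 - r) * qq a r = r * (1 - r ^ a) := by
  induction a with
  | zero => simp [qq]
  | succ a ih =>
    unfold qq at *
    rw [Finset.sum_range_succ, mul_add, ih]; ring

lemma qq_pos {α : ℕ} {r : ℝ} (hα : 1 ≤ α) (hr0 : 0 < r) : 0 < qq α r := by
  apply Finset.sum_pos
  · intros; positivity
  · simp; omega

lemma sum_phi {α : ℕ} {r : ℝ} (hα : 1 ≤ α) (hr1 : r < 1)
    (hroot : 1 - 2 * r - r ^ 2 + 2 * r ^ (α + 1) - 2 * r ^ (α + 2) + 2 * r ^ (2 * α + 2) = 0)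
    (p : ℤ) [DecidablePred (okD α p)] :
    ∑ d ∈ (Finset.Icc (-(α : ℤ)) α).filter (okD α p), phi α r d * r ^ (d.natAbs + 1) = phi α r p := by
  by_cases hp : p = α
  · rw [phi, if_pos (by omega), qq]
    symm
    apply Finset.sum_nbij (fun j : ℕ => (j : ℤ))
    · intro j hj
      simp only [Finset.mem_range, Finset.mem_filter, Finset.mem_Icc, okD, abs_le] at *
      omega
    · intro a _ b _ h; simpa using h
    · intro d hd
      simp only [Finset.coe_filter, Finset.mem_Icc, okD, abs_le, Set.mem_ofPred_eq] at hd
      refine ⟨d.natAbs, ?_, ?_⟩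
      · simp; omega
      · simp; omega
    · intro j hj
      simp at hj
      rw [phi, if_neg (by simp; omega)]; simp
  by_cases hp' : p = -α
  · rw [phi, if_pos (by omega), qq]
    symm
    apply Finset.sum_nbij (fun j : ℕ => -(j : ℤ))
    · intro j hj
      simp only [Finset.mem_range, Finset.mem_filter, Finset.mem_Icc, okD, abs_le] at *
      omega
    · intro a _ b _ h; simpa using h
    · intro d hd
      simp only [Finset.coe_filter, Finset.mem_Icc, okD, abs_le, Set.mem_ofPred_eq] at hd
      refine ⟨d.natAbs, ?_, ?_⟩
      · simp; omega
      · show -((d.natAbs : ℕ) : ℤ) = d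
        omega
    · intro j hj
      simp at hj
      rw [phi, if_neg (by simp; omega)]; simp
  rw [Finset.filter_true_of_mem, phi, if_neg (by omega)]
  · have := sum_sym (fun j => (if j = α then qq α r else 1) * r ^ (j + 1)) α
    simp only [phi]
    rw [this]
    obtain ⟨b, rfl⟩ : ∃ b, α = b + 1 := ⟨α - 1, by omega⟩
    rw [Finset.sum_range_succ, if_neg (by omega), if_pos rfl]
    have h1 : ∑ j ∈ Finset.range b, (if j + 1 = b + 1 then qq (b + 1) r else 1) * r ^ (j + 1 + 1) =
        r * qq b r := by
      rw [show qq b r = ∑ j ∈ Finset.range b, r ^ (j + 1) from rfl, Finset.mul_sum]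
      apply Finset.sum_congr rfl
      intro j hj
      simp at hj
      rw [if_neg (by omega)]; ring
    rw [h1]
    have g1 := qq_geom b r
    have g2 := qq_geom (b + 1) r
    have hne : 1 - r ≠ 0 := by linarith
    apply mul_left_cancel₀ hne
    have : (1 - r) * (1 * r ^ (0 + 1) + 2 * (r * qq b r + qq (b + 1) r * r ^ (b + 1 + 1))) =
      (1 - r) * r + 2 * r * ((1 - r) * qq b r) + 2 * r ^ (b + 2) * ((1 - r) * qq (b + 1) r) := by ring
    rw [this, g1, g2]
    linear_combination -hroot
  · intro d hd
    simp only [Finset.mem_Icc] at hd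
    exact ⟨abs_le.2 hd, fun h => absurd h hp, fun h => absurd h hp'⟩

lemma phi_pos {α : ℕ} {r : ℝ} (hα : 1 ≤ α) (hr0 : 0 < r) (p : ℤ) : 0 < phi α r p := by
  unfold phi; split_ifs
  · exact qq_pos hα hr0
  · norm_num

lemma card_upper {α : ℕ} {r : ℝ} (hα : 1 ≤ α) (hr0 : 0 < r) (hr1 : r < 1)
    (hroot : 1 - 2 * r - r ^ 2 + 2 * r ^ (α + 1) - 2 * r ^ (α + 2) + 2 * r ^ (2 * α + 2) = 0) (f : ℕ) :
    ∀ (p : ℤ) (m : ℕ), m ≤ f →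
      ((LS α f p m).card : ℝ) * r ^ m ≤ (1 / qq α r + 1) * phi α r p := by
  classical
  have hq := qq_pos hα hr0
  have base : ∀ p, 1 ≤ (1 / qq α r + 1) * phi α r p := by
    intro p
    unfold phi; split_ifs
    · rw [add_mul, one_div_mul_cancel hq.ne']; linarith
    · have : 0 < 1 / qq α r := by positivity
      linarith
  induction f with
  | zero =>
    intro p m hm
    obtain rfl : m = 0 := by omega
    simpa [LS] using base p
  | succ f ih =>
    rintro p (_ | m) hm
    · simpa [LS] using base p
    · rw [card_LS]
      push_cast
      rw [← sum_phi hα hr1 hroot p, Finset.sum_mul, Finset.mul_sum]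
      calc _ ≤ ∑ d ∈ (Finset.Icc (-(α : ℤ)) α).filter (fun d => okD α p d ∧ d.natAbs ≤ m),
            (1 / qq α r + 1) * (phi α r d * r ^ (d.natAbs + 1)) := by
            apply Finset.sum_le_sum
            intro d hd
            simp only [Finset.mem_filter] at hd
            have e : m + 1 = (m - d.natAbs) + (d.natAbs + 1) := by omega
            rw [e, pow_add r (m - d.natAbs), ← mul_assoc, ← mul_assoc]
            apply mul_le_mul_of_nonneg_right _ (by positivity)
            exact ih d _ (by omega)
        _ ≤ _ := by
            apply Finset.sum_le_sum_of_subset_of_nonneg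
            · intro d; simp only [Finset.mem_filter]; tauto
            · intro d _ _
              have := phi_pos hα hr0 d
              positivity

lemma Val_zero {α : ℕ} (hα : 1 ≤ α) (m : ℕ) : ∀ p, Val α p (List.replicate m 0) := by
  induction m with
  | zero => intro _; trivial
  | succ m ih => intro p; exact ⟨okD_zero hα p, ih 0⟩

lemma card_lower {α : ℕ} {r : ℝ} (hα : 1 ≤ α) (hr0 : 0 < r) (hr1 : r < 1)
    (hroot : 1 - 2 * r - r ^ 2 + 2 * r ^ (α + 1) - 2 * r ^ (α + 2) + 2 * r ^ (2 * α + 2) = 0) (f : ℕ) :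
    ∀ (p : ℤ) (m : ℕ), m ≤ f →
      (r ^ (α + 1) / (qq α r + 1)) * phi α r p ≤ ((LS α f p m).card : ℝ) * r ^ m := by
  classical
  have hq := qq_pos hα hr0
  have base : ∀ f p m, m ≤ f → m ≤ α →
      (r ^ (α + 1) / (qq α r + 1)) * phi α r p ≤ ((LS α f p m).card : ℝ) * r ^ m := by
    intro f p m hm hm2
    have h1 : (1 : ℝ) ≤ (LS α f p m).card := by
      have : 0 < (LS α f p m).card := by
        apply Finset.card_pos.2
        refine ⟨List.replicate m 0, ?_⟩
        rw [mem_LS _ _ _ _ hm]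
        exact ⟨Val_zero hα m p, wt_zero m⟩
      exact_mod_cast this
    have h2 : r ^ (α + 1) ≤ r ^ m := pow_le_pow_of_le_one hr0.le hr1.le (by omega)
    have h3 : phi α r p ≤ qq α r + 1 := by unfold phi; split_ifs <;> linarith
    calc _ ≤ (r ^ (α + 1) / (qq α r + 1)) * (qq α r + 1) := by gcongr
      _ = r ^ (α + 1) := by field_simp
      _ ≤ r ^ m := h2
      _ ≤ _ := le_mul_of_one_le_left (by positivity) h1
  induction f with
  | zero =>
    intro p m hm
    exact base _ _ _ hm (by omega)
  | succ f ih =>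
    intro p m hm
    by_cases hma : m ≤ α
    · exact base _ _ _ hm hma
    obtain ⟨m, rfl⟩ : ∃ k, m = k + 1 := ⟨m - 1, by omega⟩
    rw [card_LS]
    push_cast
    rw [← sum_phi hα hr1 hroot p, Finset.sum_mul, Finset.mul_sum]
    have hf : (Finset.Icc (-(α : ℤ)) α).filter (fun d => okD α p d ∧ d.natAbs ≤ m) =
        (Finset.Icc (-(α : ℤ)) α).filter (okD α p) := by
      apply Finset.filter_congr
      intro d hd
      simp only [Finset.mem_Icc] at hd
      have : d.natAbs ≤ m := by omega
      simp [this]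
    rw [hf]
    apply Finset.sum_le_sum
    intro d hd
    simp only [Finset.mem_filter, Finset.mem_Icc] at hd
    have e : m + 1 = (m - d.natAbs) + (d.natAbs + 1) := by omega
    rw [e, pow_add r (m - d.natAbs), ← mul_assoc, ← mul_assoc]
    apply mul_le_mul_of_nonneg_right _ (by positivity)
    exact ih d _ (by omega)

theorem shape1_growth_rate_even (n α : ℕ) (hn : 2 ≤ n) (heven : Even n) (hα : α = n / 2)
    (r : ℝ) (hr0 : 0 < r) (hr1 : r < 1)
    (hroot : 1 - 2 * r - r ^ 2 + 2 * r ^ (α + 1) - 2 * r ^ (α + 2) + 2 * r ^ (2 * α + 2) = 0) :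
    Tendsto (fun N : ℕ => ((OnLang n ∩ {wd : List Letter | wd.length = N}).ncard : ℝ)
        ^ (1 / (N : ℝ)))
      atTop (𝓝 (1 / r)) := by
  obtain ⟨k, rfl⟩ := heven
  obtain rfl : α = k := by omega
  rw [← two_mul]
  have hα : 1 ≤ α := by omega
  have hq := qq_pos hα hr0
  have hp0 : phi α r 0 = 1 := by rw [phi, if_neg (by simp; omega)]
  set C := 1 / qq α r + 1 with hC
  have hCp : 0 < C := by positivity
  set c := r ^ (α + 1) / (qq α r + 1) with hc
  have hcp : 0 < c := by positivity
  set a : ℕ → ℕ := fun N => (OnLang (2 * α) ∩ {wd : List Letter | wd.length = N}).ncard with ha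
  have up : ∀ N, (a N : ℝ) * r ^ N ≤ (N + 1) * C := by
    intro N
    have h1 : (a N : ℝ) ≤ ∑ u ∈ Finset.range (N + 1), ((LS α N 0 (N - u)).card : ℝ) := by
      exact_mod_cast (upper_set hα N).2
    calc _ ≤ (∑ u ∈ Finset.range (N + 1), ((LS α N 0 (N - u)).card : ℝ)) * r ^ N := by gcongr
      _ = ∑ u ∈ Finset.range (N + 1), ((LS α N 0 (N - u)).card : ℝ) * r ^ N := by rw [Finset.sum_mul]
      _ ≤ ∑ u ∈ Finset.range (N + 1), C := by
        apply Finset.sum_le_sum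
        intro u hu
        have := card_upper hα hr0 hr1 hroot N 0 (N - u) (Nat.sub_le N u)
        rw [hp0, mul_one] at this
        refine le_trans ?_ this
        apply mul_le_mul_of_nonneg_left _ (Nat.cast_nonneg _)
        exact pow_le_pow_of_le_one hr0.le hr1.le (Nat.sub_le N u)
      _ = _ := by rw [Finset.sum_const, Finset.card_range, nsmul_eq_mul]; push_cast; rfl
  have low : ∀ᶠ N in atTop, c / 2 ≤ (a N : ℝ) * r ^ N := by
    have ht := tendsto_pow_atTop_nhds_zero_of_lt_one hr0.le hr1
    filter_upwards [ht.eventually (gt_mem_nhds (show (0:ℝ) < c / 2 by positivity))] with N hN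
    have h1 := card_lower hα hr0 hr1 hroot N 0 N le_rfl
    rw [hp0, mul_one] at h1
    have h2 : ((LS α N 0 N).card : ℝ) ≤ a N + 1 := by exact_mod_cast lower_set hα N
    have h3 : ((LS α N 0 N).card : ℝ) * r ^ N ≤ (a N + 1) * r ^ N := by gcongr
    linarith
  have hinv : Tendsto (fun N : ℕ => 1 / (N : ℝ)) atTop (𝓝 0) := tendsto_one_div_atTop_nhds_zero_nat
  have hconst : ∀ b : ℝ, 0 < b → Tendsto (fun N : ℕ => b ^ (1 / (N : ℝ))) atTop (𝓝 1) := by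
    intro b hb
    have := (Real.continuousAt_const_rpow (b := 0) hb.ne').tendsto.comp hinv
    simpa [Function.comp_def] using this
  have hN : Tendsto (fun N : ℕ => (N : ℝ) ^ (1 / (N : ℝ))) atTop (𝓝 1) :=
    tendsto_rpow_div.comp tendsto_natCast_atTop_atTop
  have hmid : Tendsto (fun N : ℕ => ((a N : ℝ) * r ^ N) ^ (1 / (N : ℝ))) atTop (𝓝 1) := by
    have hupper := (hconst (2 * C) (by positivity)).mul hN
    rw [mul_one] at hupper
    refine tendsto_of_tendsto_of_tendsto_of_le_of_le' (hconst (c / 2) (by positivity)) hupper ?_ ?_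
    · filter_upwards [low] with N h
      exact Real.rpow_le_rpow (by positivity) h (by positivity)
    · filter_upwards [eventually_ge_atTop 1] with N h
      rw [← Real.mul_rpow (by positivity) (by positivity)]
      apply Real.rpow_le_rpow (by positivity) _ (by positivity)
      have hN1 : (1 : ℝ) ≤ N := by exact_mod_cast h
      have := up N
      nlinarith
  have hfin := hmid.div_const r
  refine hfin.congr' ?_
  filter_upwards [eventually_ge_atTop 1] with N h
  rw [Real.mul_rpow (by positivity) (by positivity), one_div, Real.pow_rpow_inv_natCast hr0.le (by omega)]
  field_simp
  rfl
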